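/- Let α > 0, Δ > 0, j ∈ ℕ, λ ≥ 0 and μ, σ ∈ ℝ. Let ξ be a real random variable with E[ξ⁴] < ∞ and characteristic function φ, and set K₁(u) = ∫_{jΔ}^{(j+1)Δ} φ( u e^{−α((j+1)Δ − s)} ) ds, K₂(u) = ∫_0^{jΔ} φ( u (e^{−αΔ} − 1) e^{−α(jΔ − s)} ) ds, E_{j,k}(α) = (1 − e^{−kαΔ}) + (−1)^k (1 − e^{−αΔ})^k (1 − e^{−kαjΔ}), and T₁(u) = −λ(j+1)Δ + i μ e^{−αjΔ}(1 − e^{−αΔ}) u − (σ²/(4α)) E_{j,2}(α) u² + λ ( K₁(u) + K₂(u) ). If X is a real random variable with E[X⁴] < ∞ whose characteristic function is exp(T₁(u)), then, writing m = μ e^{−αjΔ}(1 − e^{−αΔ}) + (λ/α) E[ξ] E_{j,1}(α), v = (λ E[ξ²] + σ²) E_{j,2}(α)/(2α) and w = λ E[ξ³] E_{j,3}(α)/(3α), one has E[X⁴] = λ E[ξ⁴] E_{j,4}(α)/(4α) + 4 m w + 3 v² + 6 m² v + m⁴. -/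

import Mathlib

open MeasureTheory

/-- The `k`-th derivative of the characteristic function of `Y` under `Q`, as a function of `u`. -/
noncomputable def charFunDeriv {S : Type*} [MeasurableSpace S] (Q : Measure S) (Y : S → ℝ)
    (k : ℕ) (u : ℝ) : ℂ :=
  ∫ ω, (Complex.I * (Y ω : ℂ)) ^ k * Complex.exp (Complex.I * (u : ℂ) * (Y ω : ℂ)) ∂Q

lemma norm_exp_I_mul_ofReal_mul_ofReal (u y : ℝ) :
    ‖Complex.exp (Complex.I * (u : ℂ) * (y : ℂ))‖ = 1 := by
  rw [show Complex.I * (u : ℂ) * (y : ℂ) = ((u * y : ℝ) : ℂ) * Complex.I by push_cast; ring]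
  exact Complex.norm_exp_ofReal_mul_I _

lemma memLp_four_of_integrable_pow {S : Type*} [MeasurableSpace S] {Q : Measure S} {Y : S → ℝ}
    (hY : Measurable Y) (h : Integrable (fun ω => Y ω ^ 4) Q) : MemLp Y (4 : ℕ) Q := by
  rw [← integrable_norm_rpow_iff hY.aestronglyMeasurable (by simp) (by simp)]
  refine h.congr (Filter.Eventually.of_forall fun ω => ?_)
  simp only [ENNReal.toReal_natCast, Real.rpow_natCast, Real.norm_eq_abs]
  exact ((show Even 4 by decide).pow_abs _).symm

section charFunDeriv

variable {S : Type*} [MeasurableSpace S] {Q : Measure S} [IsFiniteMeasure Q] {Y : S → ℝ} {n : ℕ}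

lemma integrable_abs_pow_of_memLp (h : MemLp Y n Q) {k : ℕ} (hk : k ≤ n) :
    Integrable (fun ω => |Y ω| ^ k) Q :=
  (h.mono_exponent (by exact_mod_cast hk)).integrable_norm_pow'

lemma measurable_charFunDeriv_integrand (hY : Measurable Y) (k : ℕ) (u : ℝ) :
    Measurable fun ω =>
      (Complex.I * (Y ω : ℂ)) ^ k * Complex.exp (Complex.I * (u : ℂ) * (Y ω : ℂ)) := by
  fun_prop

lemma norm_charFunDeriv_integrand (k : ℕ) (u y : ℝ) :
    ‖(Complex.I * (y : ℂ)) ^ k * Complex.exp (Complex.I * (u : ℂ) * (y : ℂ))‖ = |y| ^ k := by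
  rw [norm_mul, norm_exp_I_mul_ofReal_mul_ofReal, norm_pow, norm_mul, Complex.norm_I,
    Complex.norm_real, Real.norm_eq_abs, one_mul, mul_one]

lemma integrable_charFunDeriv_integrand (hY : Measurable Y) (h : MemLp Y n Q) {k : ℕ}
    (hk : k ≤ n) (u : ℝ) :
    Integrable (fun ω =>
      (Complex.I * (Y ω : ℂ)) ^ k * Complex.exp (Complex.I * (u : ℂ) * (Y ω : ℂ))) Q :=
  (integrable_abs_pow_of_memLp h hk).mono'
    (measurable_charFunDeriv_integrand hY k u).aestronglyMeasurable
    (Filter.Eventually.of_forall fun ω => (norm_charFunDeriv_integrand k u (Y ω)).le)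

lemma hasDerivAt_charFunDeriv (hY : Measurable Y) (h : MemLp Y n Q) {k : ℕ} (hk : k < n) (u : ℝ) :
    HasDerivAt (charFunDeriv Q Y k) (charFunDeriv Q Y (k + 1) u) u := by
  refine (hasDerivAt_integral_of_dominated_loc_of_deriv_le (s := Set.univ)
    (bound := fun ω => |Y ω| ^ (k + 1)) Filter.univ_mem
    (Filter.Eventually.of_forall fun v =>
      (measurable_charFunDeriv_integrand hY k v).aestronglyMeasurable)
    (integrable_charFunDeriv_integrand hY h hk.le u)
    (measurable_charFunDeriv_integrand hY (k + 1) u).aestronglyMeasurable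
    (Filter.Eventually.of_forall fun ω v _ => (norm_charFunDeriv_integrand (k + 1) v (Y ω)).le)
    (integrable_abs_pow_of_memLp h hk)
    (Filter.Eventually.of_forall fun ω v _ => ?_)).2
  have h1 : HasDerivAt (fun v : ℝ => Complex.I * (v : ℂ) * (Y ω : ℂ))
      (Complex.I * 1 * (Y ω : ℂ)) v :=
    ((Complex.ofRealCLM.hasDerivAt (x := v)).const_mul Complex.I).mul_const _
  refine HasDerivAt.congr_deriv (h1.cexp.const_mul ((Complex.I * (Y ω : ℂ)) ^ k)) ?_
  ring

end charFunDeriv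

lemma charFunDeriv_zero {S : Type*} [MeasurableSpace S] (Q : Measure S) (Y : S → ℝ) (k : ℕ) :
    charFunDeriv Q Y k 0 = Complex.I ^ k * ((∫ ω, Y ω ^ k ∂Q : ℝ) : ℂ) := by
  rw [← integral_complex_ofReal, ← integral_const_mul]
  simp [charFunDeriv, mul_pow]

section timeAverage

variable {Ω : Type*} [MeasurableSpace Ω] {P : Measure Ω} {ξ : Ω → ℝ}
  {c : ℝ → ℝ}

lemma memLp_four_mul_prod (hξ : Measurable ξ) (hint : Integrable (fun ω => ξ ω ^ 4) P)
    (hc : Continuous c) (a b : ℝ) :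
    MemLp (fun p : ℝ × Ω => c p.1 * ξ p.2) (4 : ℕ)
      ((volume.restrict (Set.Ioc a b)).prod P) := by
  refine memLp_four_of_integrable_pow (by have := hc.measurable; fun_prop) ?_
  simp only [mul_pow]
  exact Integrable.mul_prod (f := fun s => c s ^ 4) (g := fun ω => ξ ω ^ 4)
    (((hc.pow 4).integrableOn_Icc (a := a) (b := b)).mono_set Set.Ioc_subset_Icc_self) hint

lemma intervalIntegral_charFun_mul [IsFiniteMeasure P] (hξ : Measurable ξ) (hc : Continuous c)
    {a b : ℝ} (hab : a ≤ b) (u : ℝ) :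
    ∫ s in a..b, ∫ ω, Complex.exp (Complex.I * ((u * c s : ℝ) : ℂ) * (ξ ω : ℂ)) ∂P
      = charFunDeriv ((volume.restrict (Set.Ioc a b)).prod P)
          (fun p : ℝ × Ω => c p.1 * ξ p.2) 0 u := by
  have hmeas : Measurable fun p : ℝ × Ω => c p.1 * ξ p.2 := by
    have := hc.measurable
    fun_prop
  rw [charFunDeriv, intervalIntegral.integral_of_le hab, integral_prod]
  · refine integral_congr_ae (Filter.Eventually.of_forall fun s => ?_)
    refine integral_congr_ae (Filter.Eventually.of_forall fun ω => ?_)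
    simp only [pow_zero, one_mul]
    congr 1
    push_cast
    ring
  · exact integrable_charFunDeriv_integrand (n := 0) hmeas
      (by simpa using hmeas.aestronglyMeasurable) le_rfl u

lemma integral_prod_mul_pow [SFinite P] (k : ℕ) {a b : ℝ} (hab : a ≤ b) :
    ∫ p : ℝ × Ω, (c p.1 * ξ p.2) ^ k ∂((volume.restrict (Set.Ioc a b)).prod P)
      = (∫ s in a..b, c s ^ k) * ∫ ω, ξ ω ^ k ∂P := by
  simp only [mul_pow]
  rw [integral_prod_mul (fun s => c s ^ k) (fun ω => ξ ω ^ k),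
    intervalIntegral.integral_of_le hab]

end timeAverage

lemma integral_exp_decay {r : ℝ} (hr : r ≠ 0) (a b : ℝ) :
    ∫ s in a..b, Real.exp (-r * (b - s)) = (1 - Real.exp (-r * (b - a))) / r := by
  have hderiv : ∀ s ∈ Set.uIcc a b,
      HasDerivAt (fun s => Real.exp (-r * (b - s)) / r) (Real.exp (-r * (b - s))) s := by
    intro s _
    have h := ((((hasDerivAt_id s).const_sub b).const_mul (-r)).exp).div_const r
    refine h.congr_deriv ?_
    simp only [id]
    field_simp
  rw [intervalIntegral.integral_eq_sub_of_hasDerivAt hderiv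
    (Continuous.intervalIntegrable (by fun_prop) _ _)]
  simp
  ring

/-- The fourth moment-cumulant relation, for the successive derivatives `G k` of `exp ∘ C 0`. -/
lemma fourth_deriv_eq_of_eq_exp {G C : ℕ → ℝ → ℂ}
    (hG : ∀ k < 4, ∀ u, HasDerivAt (G k) (G (k + 1) u) u)
    (hC : ∀ k < 4, ∀ u, HasDerivAt (C k) (C (k + 1) u) u)
    (h : ∀ u, G 0 u = Complex.exp (C 0 u)) (u : ℝ) :
    G 4 u = (C 4 u + 4 * C 1 u * C 3 u + 3 * C 2 u ^ 2 + 6 * C 1 u ^ 2 * C 2 u + C 1 u ^ 4)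
      * Complex.exp (C 0 u) := by
  have c0 := hC 0 (by norm_num)
  have c1 := hC 1 (by norm_num)
  have c2 := hC 2 (by norm_num)
  have c3 := hC 3 (by norm_num)
  have h1 : ∀ u, G 1 u = C 1 u * Complex.exp (C 0 u) := fun u => by
    refine (hG 0 (by norm_num) u).unique ?_
    rw [funext h]
    refine (c0 u).cexp.congr_deriv ?_
    ring
  have h2 : ∀ u, G 2 u = (C 2 u + C 1 u ^ 2) * Complex.exp (C 0 u) := fun u => by
    refine (hG 1 (by norm_num) u).unique ?_
    rw [funext h1]
    refine HasDerivAt.congr_deriv ((c1 u).mul (c0 u).cexp) ?_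
    ring
  have h3 : ∀ u, G 3 u = (C 3 u + 3 * C 1 u * C 2 u + C 1 u ^ 3) *
      Complex.exp (C 0 u) := fun u => by
    refine (hG 2 (by norm_num) u).unique ?_
    rw [funext h2]
    refine HasDerivAt.congr_deriv (((c2 u).add ((c1 u).pow 2)).mul (c0 u).cexp) ?_
    simp only [Pi.add_apply, Pi.pow_apply]
    push_cast
    ring
  refine (hG 3 (by norm_num) u).unique ?_
  rw [funext h3]
  refine HasDerivAt.congr_deriv
    ((((c3 u).add (((c1 u).const_mul 3).mul (c2 u))).add ((c1 u).pow 3)).mul (c0 u).cexp) ?_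
  simp only [Pi.add_apply, Pi.pow_apply, Pi.mul_apply]
  push_cast
  ring

/-- Fourth moment of the log-return of the mean-reverting jump-diffusion model. -/
theorem logReturn_fourth_moment {Ω Ωx : Type*} [MeasurableSpace Ω] [MeasurableSpace Ωx]
    (P : Measure Ω) (Px : Measure Ωx)
    [IsProbabilityMeasure P] [IsProbabilityMeasure Px]
    (α Δ lam μ σ : ℝ) (j : ℕ) (hα : 0 < α) (hΔ : 0 < Δ) (hlam : 0 ≤ lam)
    (ξ : Ω → ℝ) (hξmeas : Measurable ξ)
    (φ : ℝ → ℂ)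
    (hφ : ∀ u : ℝ, φ u = ∫ ω, Complex.exp (Complex.I * (u : ℂ) * (ξ ω : ℂ)) ∂P)
    (K₁ K₂ : ℝ → ℂ)
    (hK₁ : ∀ u : ℝ, K₁ u =
      ∫ s in ((j : ℝ) * Δ)..(((j : ℝ) + 1) * Δ), φ (u * Real.exp (-α * (((j : ℝ) + 1) * Δ - s))))
    (hK₂ : ∀ u : ℝ, K₂ u =
      ∫ s in (0:ℝ)..((j : ℝ) * Δ),
        φ (u * (Real.exp (-α * Δ) - 1) * Real.exp (-α * ((j : ℝ) * Δ - s))))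
    (E : ℕ → ℝ)
    (hE : ∀ k : ℕ, E k = (1 - Real.exp (-(k : ℝ) * α * Δ))
        + (-1 : ℝ) ^ k * (1 - Real.exp (-α * Δ)) ^ k * (1 - Real.exp (-(k : ℝ) * α * (j : ℝ) * Δ)))
    (T₁ : ℝ → ℂ)
    (hT₁ : ∀ u : ℝ, T₁ u = -((lam * ((j : ℝ) + 1) * Δ : ℝ) : ℂ)
        + Complex.I * ((μ * Real.exp (-α * (j : ℝ) * Δ) * (1 - Real.exp (-α * Δ)) : ℝ) : ℂ) * (u : ℂ)
        - ((σ ^ 2 / (4 * α) * E 2 : ℝ) : ℂ) * (u : ℂ) ^ 2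
        + ((lam : ℝ) : ℂ) * (K₁ u + K₂ u))
    (X : Ωx → ℝ) (hXmeas : Measurable X)
    (hchar : ∀ u : ℝ, ∫ ω, Complex.exp (Complex.I * (u : ℂ) * (X ω : ℂ)) ∂Px = Complex.exp (T₁ u))
    (hξint : Integrable (fun ω => ξ ω ^ 4) P)
    (hXint : Integrable (fun ω => X ω ^ 4) Px)
    (m v w : ℝ)
    (hm : m = μ * Real.exp (-α * (j : ℝ) * Δ) * (1 - Real.exp (-α * Δ))
        + lam / α * (∫ ω, ξ ω ∂P) * E 1)
    (hv : v = (lam * (∫ ω, ξ ω ^ 2 ∂P) + σ ^ 2) * E 2 / (2 * α))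
    (hw : w = lam * (∫ ω, ξ ω ^ 3 ∂P) * E 3 / (3 * α)) :
    ∫ ω, X ω ^ 4 ∂Px
      = lam * (∫ ω, ξ ω ^ 4 ∂P) * E 4 / (4 * α) + 4 * m * w + 3 * v ^ 2
        + 6 * m ^ 2 * v + m ^ 4 := by
  set c₁ : ℝ → ℝ := fun s => Real.exp (-α * (((j : ℝ) + 1) * Δ - s)) with hc₁
  set c₂ : ℝ → ℝ := fun s =>
    (Real.exp (-α * Δ) - 1) * Real.exp (-α * ((j : ℝ) * Δ - s)) with hc₂
  have hcont₁ : Continuous c₁ := by fun_prop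
  have hcont₂ : Continuous c₂ := by fun_prop
  have hj : 0 ≤ (j : ℝ) * Δ := by positivity
  have hj' : (j : ℝ) * Δ ≤ ((j : ℝ) + 1) * Δ := by nlinarith
  set Q₁ := (volume.restrict (Set.Ioc ((j : ℝ) * Δ) (((j : ℝ) + 1) * Δ))).prod P
  set Q₂ := (volume.restrict (Set.Ioc 0 ((j : ℝ) * Δ))).prod P
  set M₁ := charFunDeriv Q₁ (fun p : ℝ × Ω => c₁ p.1 * ξ p.2) with hM₁
  set M₂ := charFunDeriv Q₂ (fun p : ℝ × Ω => c₂ p.1 * ξ p.2) with hM₂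
  have hdM₁ : ∀ k < 4, ∀ u, HasDerivAt (M₁ k) (M₁ (k + 1) u) u := fun k hk u =>
    hasDerivAt_charFunDeriv (by have := hcont₁.measurable; fun_prop)
      (memLp_four_mul_prod hξmeas hξint hcont₁ _ _) hk u
  have hdM₂ : ∀ k < 4, ∀ u, HasDerivAt (M₂ k) (M₂ (k + 1) u) u := fun k hk u =>
    hasDerivAt_charFunDeriv (by have := hcont₂.measurable; fun_prop)
      (memLp_four_mul_prod hξmeas hξint hcont₂ _ _) hk u
  have hKM₁ : ∀ u, K₁ u = M₁ 0 u := fun u => by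
    rw [hK₁, hM₁, ← intervalIntegral_charFun_mul hξmeas hcont₁ hj']
    simp only [hφ, hc₁]
  have hKM₂ : ∀ u, K₂ u = M₂ 0 u := fun u => by
    rw [hK₂, hM₂, ← intervalIntegral_charFun_mul hξmeas hcont₂ hj]
    simp only [hφ, hc₂, mul_assoc]
  have hsum : ∀ k, M₁ k 0 + M₂ k 0 = Complex.I ^ k *
      ((((∫ s in ((j : ℝ) * Δ)..(((j : ℝ) + 1) * Δ), c₁ s ^ k)
        + ∫ s in (0 : ℝ)..((j : ℝ) * Δ), c₂ s ^ k) * ∫ ω, ξ ω ^ k ∂P : ℝ) : ℂ) := fun k => by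
    rw [hM₁, hM₂, charFunDeriv_zero, charFunDeriv_zero, integral_prod_mul_pow k hj',
      integral_prod_mul_pow k hj]
    push_cast
    ring
  have hE' : ∀ k : ℕ, k ≠ 0 → (∫ s in ((j : ℝ) * Δ)..(((j : ℝ) + 1) * Δ), c₁ s ^ k)
      + ∫ s in (0 : ℝ)..((j : ℝ) * Δ), c₂ s ^ k = E k / (k * α) := fun k hk => by
    have hk' : (k : ℝ) * α ≠ 0 := by positivity
    have e : ∀ b s : ℝ, Real.exp (-α * (b - s)) ^ k = Real.exp (-(k * α) * (b - s)) := fun b s => by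
      rw [← Real.exp_nat_mul]
      congr 1
      ring
    simp only [hc₁, hc₂, mul_pow, e, intervalIntegral.integral_const_mul]
    rw [integral_exp_decay hk', integral_exp_decay hk', hE, ← mul_pow,
      show -(k * α) * (((j : ℝ) + 1) * Δ - j * Δ) = -(k : ℝ) * α * Δ by ring,
      show -(k * α) * ((j : ℝ) * Δ - 0) = -(k : ℝ) * α * j * Δ by ring,
      show (-1 : ℝ) * (1 - Real.exp (-α * Δ)) = Real.exp (-α * Δ) - 1 by ring]
    ring
  set A : ℝ := μ * Real.exp (-α * (j : ℝ) * Δ) * (1 - Real.exp (-α * Δ))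
  set B : ℝ := σ ^ 2 / (4 * α) * E 2 with hB
  let C : ℕ → ℝ → ℂ := fun k u => lam * (M₁ k u + M₂ k u) + match k with
    | 0 => -((lam * ((j : ℝ) + 1) * Δ : ℝ) : ℂ) + Complex.I * A * u - B * (u : ℂ) ^ 2
    | 1 => Complex.I * A - 2 * B * u
    | 2 => -2 * B
    | _ => 0
  have hT₁C : ∀ u, T₁ u = C 0 u := fun u => by
    rw [hT₁, hKM₁, hKM₂]
    simp only [C]
    ring
  have hCderiv : ∀ k < 4, ∀ u, HasDerivAt (C k) (C (k + 1) u) u := by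
    intro k hk u
    refine (((hdM₁ k hk u).add (hdM₂ k hk u)).const_mul (lam : ℂ)).add ?_
    have hid : HasDerivAt (fun v : ℝ => (v : ℂ)) 1 u := Complex.ofRealCLM.hasDerivAt
    interval_cases k
    · refine HasDerivAt.congr_deriv (((hid.const_mul (Complex.I * A)).const_add _).sub
        ((hid.pow 2).const_mul (B : ℂ))) ?_
      push_cast
      ring
    · refine HasDerivAt.congr_deriv ((hid.const_mul (2 * (B : ℂ))).const_sub (Complex.I * A)) ?_
      simp
    · exact hasDerivAt_const _ _
    · exact hasDerivAt_const _ _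
  have hC0 : C 0 0 = 0 := by
    simp only [C, hsum]
    simp
    ring
  have hC1 : C 1 0 = Complex.I * m := by
    simp only [C, hsum, hE' 1 one_ne_zero, hm]
    push_cast
    simp only [pow_one]
    ring
  have hC2 : C 2 0 = -v := by
    simp only [C, hsum, hE' 2 two_ne_zero, hv, hB]
    push_cast
    rw [Complex.I_sq]
    ring
  have hC3 : C 3 0 = -Complex.I * w := by
    simp only [C, hsum, hE' 3 three_ne_zero, hw]
    push_cast
    rw [Complex.I_pow_three]
    ring
  have hC4 : C 4 0 = ((lam * (∫ ω, ξ ω ^ 4 ∂P) * E 4 / (4 * α) : ℝ) : ℂ) := by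
    simp only [C, hsum, hE' 4 four_ne_zero]
    rw [Complex.I_pow_four]
    push_cast
    ring
  have key := fourth_deriv_eq_of_eq_exp (G := charFunDeriv Px X) (C := C)
    (fun k hk u => hasDerivAt_charFunDeriv hXmeas (memLp_four_of_integrable_pow hXmeas hXint) hk u)
    hCderiv (fun u => by rw [← hT₁C, ← hchar]; simp [charFunDeriv]) 0
  rw [hC0, hC1, hC2, hC3, hC4, charFunDeriv_zero, Complex.I_pow_four, Complex.exp_zero, one_mul,
    mul_one] at key
  apply Complex.ofReal_injective
  rw [key]
  push_cast
  linear_combination (-4 * (m : ℂ) * w - 6 * (m : ℂ) ^ 2 * v + (m : ℂ) ^ 4 * (Complex.I ^ 2 - 1))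
    * Complex.I_sq
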